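/- Let 𝒢 be a nilpotent subgroup of GL(n,ℝ) which is triangular, i.e., there is a complete flag of subspaces of ℂⁿ invariant under (the complexification of) every element of 𝒢. For σ ∈ 𝒢 let σ_s be the semisimple part of σ in its multiplicative Jordan decomposition, and let 𝒦 be the closure in GL(n,ℝ) of the set {σ_s : σ ∈ 𝒢}. If 𝒦 is connected, then every closed additive subgroup H of ℝⁿ satisfying σ(H) ⊆ H for all σ ∈ 𝒢 also satisfies τ(H) ⊆ H for all τ ∈ 𝒦. -/

import Mathlib

open Pointwise

/-- `σs` is the semisimple part of the multiplicative Jordan decomposition of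
`σ ∈ GL(n, ℝ)`: `σ = σs·σu = σu·σs` with `σs` semisimple (squarefree minimal
polynomial) and `σu` unipotent. -/
def IsJordanSemisimplePart {n : ℕ} (σ σs : Matrix.GeneralLinearGroup (Fin n) ℝ) : Prop :=
  ∃ σu : Matrix.GeneralLinearGroup (Fin n) ℝ,
    σ = σs * σu ∧ σs * σu = σu * σs ∧
    Squarefree (minpoly ℝ (σs : Matrix (Fin n) (Fin n) ℝ)) ∧
    ((σu : Matrix (Fin n) (Fin n) ℝ) - 1) ^ n = 0

/-- The largest linear subspace contained in an additive subgroup. -/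
def AddSubgroup.linealitySubmodule {E : Type*} [AddCommGroup E] [Module ℝ E]
    (H : AddSubgroup E) : Submodule ℝ E where
  carrier := {v | ∀ t : ℝ, t • v ∈ H}
  add_mem' ha hb t := by
    rw [smul_add]
    exact H.add_mem (ha t) (hb t)
  zero_mem' t := by simp
  smul_mem' c v hv t := by
    rw [smul_smul]
    exact hv _

theorem AddSubgroup.mem_of_mem_linealitySubmodule {E : Type*} [AddCommGroup E] [Module ℝ E]
    {H : AddSubgroup E} {v : E} (hv : v ∈ H.linealitySubmodule) : v ∈ H := by
  simpa using hv 1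

/-- A closed subgroup of a finite-dimensional space containing no line is discrete. -/
theorem AddSubgroup.exists_norm_lower_bound_of_isClosed {E : Type*} [NormedAddCommGroup E]
    [NormedSpace ℝ E] [ProperSpace E] (L : AddSubgroup E) (hL : IsClosed (L : Set E))
    (h0 : L.linealitySubmodule = ⊥) :
    ∃ ε > 0, ∀ h ∈ L, ‖h‖ < ε → h = 0 := by
  by_contra! hcon
  choose h hhL hhlt hhne using fun k : ℕ => hcon (1 / ((k : ℝ) + 1)) (by positivity)
  have hnorm : ∀ k, ‖h k‖ ≠ 0 := fun k => norm_ne_zero_iff.mpr (hhne k)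
  have hlim : Filter.Tendsto (fun k => ‖h k‖) Filter.atTop (nhds 0) :=
    squeeze_zero (fun _ => norm_nonneg _) (fun k => (hhlt k).le)
      tendsto_one_div_add_atTop_nhds_zero_nat
  obtain ⟨w, hw, φ, hφ, hu⟩ := (isCompact_sphere (0 : E) 1).tendsto_subseq
    (x := fun k => ‖h k‖⁻¹ • h k) (fun k => by simp [norm_smul, hnorm k])
  have hwL : w ∈ L.linealitySubmodule := by
    intro t
    have hdiff : Filter.Tendsto
        (fun k => ((⌊t / ‖h (φ k)‖⌋ : ℝ) - t / ‖h (φ k)‖) • h (φ k)) Filter.atTop (nhds 0) := by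
      refine squeeze_zero_norm (fun k => ?_) (hlim.comp hφ.tendsto_atTop)
      rw [norm_smul]
      refine mul_le_of_le_one_left (norm_nonneg _) ?_
      rw [Real.norm_eq_abs, abs_le]
      constructor
      · linarith [Int.sub_one_lt_floor (t / ‖h (φ k)‖)]
      · linarith [Int.floor_le (t / ‖h (φ k)‖)]
    have hsum := hdiff.add (hu.const_smul t)
    rw [zero_add] at hsum
    refine hL.mem_of_tendsto hsum (Filter.Eventually.of_forall fun k => ?_)
    have heq : ((⌊t / ‖h (φ k)‖⌋ : ℝ) - t / ‖h (φ k)‖) • h (φ k)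
        + t • ((fun k => ‖h k‖⁻¹ • h k) ∘ φ) k = ⌊t / ‖h (φ k)‖⌋ • h (φ k) := by
      simp only [Function.comp_apply, smul_smul, ← add_smul]
      rw [← Int.cast_smul_eq_zsmul ℝ]
      congr 1
      ring
    rw [heq]
    exact L.zsmul_mem (hhL _) _
  rw [h0, Submodule.mem_bot] at hwL
  simp [hwL] at hw

/-- Structure of closed subgroups: modulo its largest subspace, a closed subgroup of `E` is the
`ℤ`-span of a linearly independent family, here encoded by a linear map `B` out of coordinate
space together with a coordinate map `C`. -/
theorem AddSubgroup.exists_lattice_coordinates_of_isClosed {E : Type*} [NormedAddCommGroup E]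
    [NormedSpace ℝ E] [FiniteDimensional ℝ E] (H : AddSubgroup E) (hH : IsClosed (H : Set E)) :
    ∃ (m : ℕ) (B : (Fin m → ℝ) →ₗ[ℝ] E) (C : E →ₗ[ℝ] (Fin m → ℝ)),
      (∀ c, C (B c) = c) ∧ (∀ v ∈ H.linealitySubmodule, C v = 0) ∧
      (∀ v ∈ H, v - B (C v) ∈ H.linealitySubmodule) ∧
      (∀ v ∈ H, ∃ z : Fin m → ℤ, C v = fun i => (z i : ℝ)) ∧
      ∀ z : Fin m → ℤ, B (fun i => (z i : ℝ)) ∈ H := by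
  have := FiniteDimensional.proper_real E
  obtain ⟨W, hW⟩ := Submodule.exists_isCompl H.linealitySubmodule
  set L : AddSubgroup E := H ⊓ W.toAddSubgroup
  have hLcl : IsClosed (L : Set E) := hH.inter W.closed_of_finiteDimensional
  have hL0 : L.linealitySubmodule = ⊥ := by
    rw [eq_bot_iff]
    intro v hv
    have hvW : v ∈ W := by simpa using (hv 1).2
    exact hW.disjoint.le_bot ⟨fun t => (hv t).1, hvW⟩
  obtain ⟨ε, hε, hεL⟩ := L.exists_norm_lower_bound_of_isClosed hLcl hL0
  let Lz : Submodule ℤ E := AddSubgroup.toIntSubmodule L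
  have hdisc : DiscreteTopology Lz := by
    refine DiscreteTopology.of_forall_le_norm hε fun x hx => ?_
    by_contra! hlt
    exact hx (Subtype.ext (hεL x x.2 hlt))
  let b := Module.finBasis ℤ Lz
  have hbZ : LinearIndependent ℤ (fun i => (b i : E)) :=
    b.linearIndependent.map' Lz.subtype (Submodule.ker_subtype _)
  have hspan : Submodule.span ℤ (Set.range fun i => (b i : E)) = Lz := by
    have := congrArg (Submodule.map Lz.subtype) b.span_eq
    rw [Submodule.map_span, Submodule.map_top, Submodule.range_subtype, ← Set.range_comp] at this
    exact this
  have hbR : LinearIndependent ℝ (fun i => (b i : E)) := by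
    rw [linearIndependent_iff_card_eq_finrank_span,
      Real.finrank_eq_int_finrank_of_discrete (by rw [hspan]; exact hdisc)]
    exact (finrank_span_eq_card hbZ).symm
  let B := Fintype.linearCombination ℝ (fun i => (b i : E))
  obtain ⟨D, hD⟩ := B.exists_leftInverse_of_injective
    (LinearMap.ker_eq_bot.mpr (linearIndependent_iff_injective_fintypeLinearCombination.mp hbR))
  have hDB : ∀ c, D (B c) = c := fun c => LinearMap.congr_fun hD c
  let P := W.projection _ hW.symm
  have hPW : ∀ v, P v ∈ W := fun v => Submodule.projection_apply_mem _ v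
  have hPV : ∀ v, v - P v ∈ H.linealitySubmodule := fun v => by
    rw [← Submodule.projection_apply_eq_zero_iff hW.symm, map_sub,
      Submodule.projection_apply_of_mem_left hW.symm (hPW v), sub_self]
  have hBmem : ∀ z : Fin _ → ℤ, B (fun i => (z i : ℝ)) ∈ L := fun z => by
    simp only [B, Fintype.linearCombination_apply, Int.cast_smul_eq_zsmul]
    exact L.sum_mem fun i _ => L.zsmul_mem (b i).2 _
  have hPB : ∀ v ∈ H, ∃ z : Fin _ → ℤ, P v = B (fun i => (z i : ℝ)) := fun v hv => by
    have hPL : P v ∈ Lz := by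
      refine ⟨?_, hPW v⟩
      simpa using H.sub_mem hv (H.mem_of_mem_linealitySubmodule (hPV v))
    refine ⟨b.repr ⟨P v, hPL⟩, ?_⟩
    have := congrArg Lz.subtype (b.sum_repr ⟨P v, hPL⟩)
    rw [map_sum] at this
    simp only [B, Fintype.linearCombination_apply, Int.cast_smul_eq_zsmul]
    exact this.symm
  have hPW' : ∀ c, P (B c) = B c := fun c => by
    refine Submodule.projection_apply_of_mem_left hW.symm ?_
    rw [Fintype.linearCombination_apply]
    exact W.sum_mem fun i _ => W.smul_mem _ (b i).2.2
  refine ⟨_, B, D ∘ₗ P, fun c => ?_, fun v hv => ?_, fun v hv => ?_, fun v hv => ?_,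
    fun z => (hBmem z).1⟩
  · simp [hPW', hDB]
  · rw [LinearMap.comp_apply, (Submodule.projection_apply_eq_zero_iff hW.symm).mpr hv,
      map_zero]
  · obtain ⟨z, hz⟩ := hPB v hv
    rw [LinearMap.comp_apply, hz, hDB, ← hz]
    exact hPV v
  · obtain ⟨z, hz⟩ := hPB v hv
    exact ⟨z, by rw [LinearMap.comp_apply, hz, hDB]⟩

/-- Adding a commuting nilpotent matrix does not change the determinant. -/
theorem Matrix.det_add_of_isNilpotent {ι K : Type*} [Fintype ι] [DecidableEq ι] [Field K]
    {A N : Matrix ι ι K} (hN : IsNilpotent N) (hAN : Commute A N) :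
    (A + N).det = A.det := by
  by_cases hA : IsUnit A
  · have hchar : N.charpoly = Polynomial.X ^ Fintype.card ι :=
      sub_eq_zero.mp (Matrix.isNilpotent_charpoly_sub_pow_of_isNilpotent hN).eq_zero
    obtain ⟨u, rfl⟩ := hA
    have hM : IsNilpotent (-((u⁻¹ : (Matrix ι ι K)ˣ) * N : Matrix ι ι K)) :=
      ((Commute.units_inv_left hAN).isNilpotent_mul_left hN).neg
    have hcM : (-((u⁻¹ : (Matrix ι ι K)ˣ) * N : Matrix ι ι K)).charpoly = Polynomial.X ^ Fintype.card ι :=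
      sub_eq_zero.mp (Matrix.isNilpotent_charpoly_sub_pow_of_isNilpotent hM).eq_zero
    have hdet : (1 + ((u⁻¹ : (Matrix ι ι K)ˣ) * N : Matrix ι ι K)).det = 1 := by
      have := congrArg (Polynomial.eval 1) hcM
      rw [Matrix.eval_charpoly] at this
      simpa using this
    have hfac : (u : Matrix ι ι K) + N = u * (1 + ((u⁻¹ : (Matrix ι ι K)ˣ) * N : Matrix ι ι K)) := by
      rw [mul_add, mul_one, ← mul_assoc, Units.mul_inv, one_mul]
    rw [hfac, Matrix.det_mul, hdet, mul_one]
  · have hAN' : ¬ IsUnit (A + N) := fun h => hA <| by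
      have := hN.neg.isUnit_add_left_of_commute h
        ((hAN.add_left (Commute.refl N)).neg_right.symm)
      simpa using this
    rw [Matrix.isUnit_iff_isUnit_det, isUnit_iff_ne_zero, not_not] at hA hAN'
    rw [hA, hAN']

/-- A real matrix annihilated by a squarefree polynomial and with characteristic polynomial
agreeing with that of the identity at all integers is the identity. -/
theorem Matrix.eq_one_of_squarefree_of_det_eq {ι : Type*} [Fintype ι] [DecidableEq ι]
    {M : Matrix ι ι ℝ} {p : Polynomial ℝ} (hp : Squarefree p) (hpM : Polynomial.aeval M p = 0)
    (hdet : ∀ x : ℤ, (Matrix.scalar ι (x : ℝ) - M).det = (Matrix.scalar ι (x : ℝ) - 1).det) :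
    M = 1 := by
  have hchar : M.charpoly = (1 : Matrix ι ι ℝ).charpoly := by
    refine Polynomial.eq_of_infinite_eval_eq _ _
      ((Set.infinite_range_of_injective (Int.cast_injective (α := ℝ))).mono ?_)
    rintro _ ⟨x, rfl⟩
    rw [Set.mem_ofPred_eq, Matrix.eval_charpoly, Matrix.eval_charpoly, hdet]
  rw [Matrix.charpoly_one] at hchar
  have hdvd : minpoly ℝ M ∣ (Polynomial.X - 1) ^ Fintype.card ι :=
    hchar ▸ Matrix.minpoly_dvd_charpoly M
  have hsq : Squarefree (minpoly ℝ M) := hp.squarefree_of_dvd (minpoly.dvd _ _ hpM)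
  obtain ⟨q, hq⟩ := hsq.isRadical _ _ hdvd
  have := congrArg (Polynomial.aeval M) hq
  rw [map_mul, minpoly.aeval, zero_mul] at this
  simpa [sub_eq_zero] using this

/-- The semisimple part of a commuting sum of a squarefree-annihilated and a nilpotent matrix is a
polynomial in the sum. -/
theorem Matrix.mem_adjoin_of_squarefree_minpoly {ι : Type*} [Fintype ι] [DecidableEq ι]
    {S N : Matrix ι ι ℝ} (hS : Squarefree (minpoly ℝ S)) (hN : IsNilpotent N)
    (hSN : Commute S N) : S ∈ Algebra.adjoin ℝ {S + N} := by
  let e : Matrix ι ι ℝ ≃ₐ[ℝ] Module.End ℝ (ι → ℝ) := Matrix.toLinAlgEquiv'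
  obtain ⟨N', hN'mem, S', hS'mem, hN', hS', hsum⟩ :=
    (e (S + N)).exists_isNilpotent_isSemisimple
  have heS : (e S).IsSemisimple := by
    refine Module.End.isSemisimple_of_squarefree_aeval_eq_zero hS ?_
    rw [Polynomial.aeval_algHom_apply, minpoly.aeval, map_zero]
  have hcomm : ∀ x ∈ Algebra.adjoin ℝ {e (S + N)}, ∀ y ∈ Algebra.adjoin ℝ {e (S + N)},
      Commute x y := fun x hx y hy =>
    Algebra.commute_of_mem_adjoin_singleton_of_commute hy
      (Algebra.commute_of_mem_adjoin_singleton_of_commute hx (Commute.refl _)).symm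
  have heq : e S = S' := (Module.End.isNilpotent_isSemisimple_unique (hN.map e) heS hN' hS'
    (hSN.symm.map e) (hcomm _ hN'mem _ hS'mem) (by rw [← hsum, map_add, add_comm])).2
  have hmem : e S ∈ (Algebra.adjoin ℝ {S + N}).map (e : Matrix ι ι ℝ →ₐ[ℝ] _) := by
    rw [AlgHom.map_adjoin_singleton, heq]
    exact hS'mem
  obtain ⟨T, hT, hTS⟩ := hmem
  exact e.injective hTS ▸ hT

/-- The subalgebra of matrices stabilizing a subspace. -/
def Matrix.stabilizerSubalgebra {n : ℕ} (V : Submodule ℝ (Fin n → ℝ)) :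
    Subalgebra ℝ (Matrix (Fin n) (Fin n) ℝ) where
  carrier := {A | ∀ v ∈ V, A.mulVec v ∈ V}
  mul_mem' ha hb v hv := by
    rw [← Matrix.mulVec_mulVec]
    exact ha _ (hb _ hv)
  add_mem' ha hb v hv := by
    rw [Matrix.add_mulVec]
    exact V.add_mem (ha v hv) (hb v hv)
  algebraMap_mem' r v hv := by
    rw [Algebra.algebraMap_eq_smul_one, Matrix.smul_mulVec, Matrix.one_mulVec]
    exact V.smul_mem r hv

/-- Given subspaces `V₀` and `V₁`, with `B` and `C` exhibiting `V₁ / V₀` as a coordinate space,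
the action on `V₁ / V₀` of matrices stabilizing both subspaces. -/
def Matrix.subquotientAlgHom {n m : ℕ} (V₀ V₁ : Submodule ℝ (Fin n → ℝ))
    (B : Matrix (Fin n) (Fin m) ℝ) (C : Matrix (Fin m) (Fin n) ℝ) (hCB : C * B = 1)
    (hC : ∀ v ∈ V₀, C.mulVec v = 0) (hB : ∀ c, B.mulVec c ∈ V₁)
    (hV : ∀ v ∈ V₁, v - B.mulVec (C.mulVec v) ∈ V₀) :
    ↥(Matrix.stabilizerSubalgebra V₀ ⊓ Matrix.stabilizerSubalgebra V₁) →ₐ[ℝ]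
      Matrix (Fin m) (Fin m) ℝ :=
  AlgHom.ofLinearMap
    { toFun := fun A => C * A.1 * B
      map_add' := fun X Y => by simp [Matrix.mul_add, Matrix.add_mul]
      map_smul' := fun r X => by simp }
    (by simpa using hCB)
    (fun X Y => by
      refine Matrix.ext_iff_mulVec.mpr fun c => ?_
      have h := hC _ (X.2.1 _ (hV _ (Y.2.2 _ (hB c))))
      rw [Matrix.mulVec_sub, Matrix.mulVec_sub, sub_eq_zero] at h
      simpa [← Matrix.mulVec_mulVec] using h)

/-- Lemma 4.3 of the paper. Let `𝒢 ≤ GL(n,ℝ)` be nilpotent and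
triangular (a complete flag of subspaces of `ℂⁿ` is invariant under the complexification
of every element), and let `𝒦` be the closure of the set of semisimple Jordan parts of
elements of `𝒢`. If `𝒦` is connected, then every closed `𝒢`-invariant additive subgroup
of `ℝⁿ` is `𝒦`-invariant. -/
theorem stmt10 {n : ℕ} (𝒢 : Subgroup (Matrix.GeneralLinearGroup (Fin n) ℝ))
    (hnil : Group.IsNilpotent ↥𝒢)
    (htri : ∃ W : Fin (n + 1) → Submodule ℂ (Fin n → ℂ), Monotone W ∧
      (∀ i : Fin (n + 1), Module.finrank ℂ ↥(W i) = (i : ℕ)) ∧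
      ∀ σ ∈ 𝒢, ∀ i : Fin (n + 1), ∀ v ∈ W i,
        Matrix.mulVec ((σ : Matrix (Fin n) (Fin n) ℝ).map (algebraMap ℝ ℂ)) v ∈ W i)
    (hconn : IsConnected (closure {τ : Matrix.GeneralLinearGroup (Fin n) ℝ |
      ∃ σ ∈ 𝒢, IsJordanSemisimplePart σ τ}))
    (H : AddSubgroup (Fin n → ℝ)) (hHcl : IsClosed (H : Set (Fin n → ℝ)))
    (hHinv : ∀ σ ∈ 𝒢, ∀ v ∈ H, Matrix.mulVec (σ : Matrix (Fin n) (Fin n) ℝ) v ∈ H) :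
    ∀ τ ∈ closure {τ : Matrix.GeneralLinearGroup (Fin n) ℝ |
        ∃ σ ∈ 𝒢, IsJordanSemisimplePart σ τ},
      ∀ v ∈ H, Matrix.mulVec (τ : Matrix (Fin n) (Fin n) ℝ) v ∈ H := by
  obtain ⟨m, B', C', hCB', hC', hBC', hCint', hBint'⟩ :=
    H.exists_lattice_coordinates_of_isClosed hHcl
  obtain ⟨B, rfl⟩ := Matrix.toLin'.surjective B'
  obtain ⟨C, rfl⟩ := Matrix.toLin'.surjective C'
  simp only [Matrix.toLin'_apply] at hCB' hC' hBC' hCint' hBint'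
  set V₀ := H.linealitySubmodule
  set V₁ : Submodule ℝ (Fin n → ℝ) := Submodule.span ℝ (H : Set (Fin n → ℝ))
  have hCB : C * B = 1 := Matrix.ext_iff_mulVec.mpr fun c => by
    rw [← Matrix.mulVec_mulVec, hCB', Matrix.one_mulVec]
  have hsingle : ∀ i, (fun j => ((Pi.single i 1 : Fin m → ℤ) j : ℝ)) = Pi.single i 1 := fun i => by
    ext j
    by_cases hij : j = i
    · subst hij; simp
    · simp [hij]
  have hB : ∀ c, B.mulVec c ∈ V₁ := fun c => by
    rw [← Matrix.toLin'_apply, (Pi.basisFun ℝ (Fin m)).sum_repr c |>.symm, map_sum]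
    refine V₁.sum_mem fun i _ => ?_
    rw [map_smul]
    refine V₁.smul_mem _ (Submodule.subset_span ?_)
    have := hBint' (Pi.single i 1)
    rw [Pi.basisFun_apply, Matrix.toLin'_apply]
    rwa [hsingle] at this
  have hV : ∀ v ∈ V₁, v - B.mulVec (C.mulVec v) ∈ V₀ := by
    have hle : V₁ ≤ V₀.comap (LinearMap.id - Matrix.toLin' B ∘ₗ Matrix.toLin' C) :=
      Submodule.span_le.mpr fun v hv => hBC' v hv
    exact fun v hv => hle hv
  let 𝒜 := Matrix.stabilizerSubalgebra V₀ ⊓ Matrix.stabilizerSubalgebra V₁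
  have h𝒢 : ∀ σ ∈ 𝒢, (σ : Matrix (Fin n) (Fin n) ℝ) ∈ 𝒜 := fun σ hσ => by
    refine ⟨fun v hv t => ?_, ?_⟩
    · rw [← Matrix.mulVec_smul]
      exact hHinv σ hσ _ (hv t)
    · have hle : V₁ ≤ V₁.comap (Matrix.toLin' (σ : Matrix (Fin n) (Fin n) ℝ)) :=
        Submodule.span_le.mpr fun v hv => Submodule.subset_span (hHinv σ hσ v hv)
      exact fun v hv => hle hv
  let Φ := Matrix.subquotientAlgHom V₀ V₁ B C hCB hC' hB hV
  set S : Set (Matrix.GeneralLinearGroup (Fin n) ℝ) :=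
    {τ | ∃ σ ∈ 𝒢, IsJordanSemisimplePart σ τ}
  have hSmem : ∀ τ ∈ S, (τ : Matrix (Fin n) (Fin n) ℝ) ∈ 𝒜 ∧ ∀ x : ℤ, ∃ k : ℤ,
      (Matrix.scalar (Fin m) (x : ℝ) - C * (τ : Matrix (Fin n) (Fin n) ℝ) * B).det = k := by
    rintro τ ⟨σ, hσ, u, hσu, hcomm, hsq, hu⟩
    set N : Matrix (Fin n) (Fin n) ℝ := τ * (u - 1) with hNdef
    have hcommM : Commute (τ : Matrix (Fin n) (Fin n) ℝ) u := congrArg Units.val hcomm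
    have hcomm1 : Commute (τ : Matrix (Fin n) (Fin n) ℝ) (u - 1) :=
      hcommM.sub_right (Commute.one_right _)
    have hN : IsNilpotent N := hcomm1.isNilpotent_mul_left ⟨n, hu⟩
    have hτN : Commute (τ : Matrix (Fin n) (Fin n) ℝ) N := (Commute.refl _).mul_right hcomm1
    have hσeq : (σ : Matrix (Fin n) (Fin n) ℝ) = τ + N := by
      rw [hσu, hNdef, mul_sub, mul_one, Units.val_mul, add_sub_cancel]
    have hτ𝒜 : (τ : Matrix (Fin n) (Fin n) ℝ) ∈ 𝒜 := by
      refine Algebra.adjoin_le ?_ (Matrix.mem_adjoin_of_squarefree_minpoly hsq hN hτN)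
      rw [← hσeq, Set.singleton_subset_iff]
      exact h𝒢 σ hσ
    have hN𝒜 : N ∈ 𝒜 := by
      rw [← add_sub_cancel_left (τ : Matrix (Fin n) (Fin n) ℝ) N, ← hσeq]
      exact 𝒜.sub_mem (h𝒢 σ hσ) hτ𝒜
    refine ⟨hτ𝒜, fun x => ?_⟩
    have hΦN : IsNilpotent (Φ ⟨N, hN𝒜⟩) := by
      refine IsNilpotent.map ?_ Φ
      obtain ⟨k, hk⟩ := hN
      exact ⟨k, Subtype.ext hk⟩
    have hΦτN : Commute (Φ ⟨τ, hτ𝒜⟩) (Φ ⟨N, hN𝒜⟩) :=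
      Commute.map (show Commute (⟨τ, hτ𝒜⟩ : 𝒜) ⟨N, hN𝒜⟩ from Subtype.ext hτN) Φ
    have hdet := Matrix.det_add_of_isNilpotent hΦN.neg
      (((Matrix.scalar_commute (x : ℝ) (fun _ => Commute.all _ _) _).sub_left hΦτN).neg_right)
    have hint : ∀ j i, ∃ z : ℤ, (C * (σ : Matrix (Fin n) (Fin n) ℝ) * B) i j = z := fun j i => by
      obtain ⟨z, hz⟩ := hCint' _ (hHinv σ hσ _ (hBint' (Pi.single j 1)))
      refine ⟨z i, ?_⟩
      rw [← congrFun hz i]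
      rw [hsingle, Matrix.mulVec_mulVec, Matrix.mulVec_mulVec, Matrix.mulVec_single_one,
        Matrix.col_apply]
    choose z hz using hint
    refine ⟨(Matrix.scalar (Fin m) x - Matrix.of fun i j => z j i).det, ?_⟩
    have hcast : (Matrix.scalar (Fin m) (x : ℝ) - C * (σ : Matrix (Fin n) (Fin n) ℝ) * B) =
        (Matrix.scalar (Fin m) x - Matrix.of fun i j => z j i).map (Int.castRingHom ℝ) := by
      ext i j
      rw [Matrix.map_apply, Matrix.sub_apply, Matrix.sub_apply, Matrix.scalar_apply,
        Matrix.scalar_apply, Matrix.of_apply, hz, Matrix.diagonal_apply, Matrix.diagonal_apply]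
      split_ifs <;> simp
    have hσΦ : C * (σ : Matrix (Fin n) (Fin n) ℝ) * B = Φ ⟨τ, hτ𝒜⟩ + Φ ⟨N, hN𝒜⟩ := by
      rw [← map_add, hσeq]
      rfl
    have hdet' := congrArg Matrix.det hcast
    rw [← RingHom.mapMatrix_apply, ← RingHom.map_det, hσΦ, ← sub_sub, sub_eq_add_neg _ (Φ ⟨N, _⟩),
      hdet] at hdet'
    exact hdet'
  have hone : (1 : Matrix.GeneralLinearGroup (Fin n) ℝ) ∈ S := by
    refine ⟨1, 𝒢.one_mem, 1, by simp, rfl, ?_, ?_⟩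
    · refine Squarefree.squarefree_of_dvd (minpoly.dvd ℝ _ (p := Polynomial.X - Polynomial.C 1) ?_)
        (Polynomial.irreducible_X_sub_C 1).squarefree
      simp
    · rcases n with _ | n
      · exact Subsingleton.elim _ _
      · simp
  have hconst : ∀ x : ℤ, ∀ τ ∈ closure S,
      (Matrix.scalar (Fin m) (x : ℝ) - C * (τ : Matrix (Fin n) (Fin n) ℝ) * B).det =
        (Matrix.scalar (Fin m) (x : ℝ) - 1).det := by
    intro x τ hτ
    let f : Matrix.GeneralLinearGroup (Fin n) ℝ → ℝ := fun τ =>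
      (Matrix.scalar (Fin m) (x : ℝ) - C * (τ : Matrix (Fin n) (Fin n) ℝ) * B).det
    have hf : Continuous f := by
      have := Units.continuous_val (M := Matrix (Fin n) (Fin n) ℝ)
      exact (continuous_const.sub
        ((continuous_const.matrix_mul this).matrix_mul continuous_const)).matrix_det
    have hcl : ∀ τ ∈ closure S, f τ ∈ Set.range ((↑) : ℤ → ℝ) := fun τ hτ =>
      closure_minimal (t := f ⁻¹' Set.range ((↑) : ℤ → ℝ))
        (fun τ hτ => ((hSmem τ hτ).2 x).imp fun _ h => h.symm)
        (Int.isClosedEmbedding_coe_real.isClosed_range.preimage hf) hτ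
    have hdisc : IsDiscrete (Set.range ((↑) : ℤ → ℝ)) :=
      Int.isClosedEmbedding_coe_real.isEmbedding.isDiscrete_range
    have := hconn.isPreconnected.constant_of_mapsTo hdisc hf.continuousOn hcl hτ
      (subset_closure hone)
    simpa [f, hCB] using this
  intro τ hτ v hv
  have hcont : Continuous fun τ : Matrix.GeneralLinearGroup (Fin n) ℝ =>
      (τ : Matrix (Fin n) (Fin n) ℝ).mulVec v :=
    (Units.continuous_val (M := Matrix (Fin n) (Fin n) ℝ)).matrix_mulVec continuous_const
  refine closure_minimal (s := S) (fun τ hτS => ?_) (hHcl.preimage hcont) hτ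
  obtain ⟨hτ𝒜, -⟩ := hSmem τ hτS
  have hsq : Squarefree (minpoly ℝ (τ : Matrix (Fin n) (Fin n) ℝ)) := by
    obtain ⟨_, _, _, _, _, h, _⟩ := hτS
    exact h
  have hΦ : C * (τ : Matrix (Fin n) (Fin n) ℝ) * B = 1 := by
    refine Matrix.eq_one_of_squarefree_of_det_eq hsq ?_
      fun x => hconst x τ (subset_closure hτS)
    change Polynomial.aeval (Φ ⟨τ, hτ𝒜⟩) _ = 0
    rw [Polynomial.aeval_algHom_apply]
    have : Polynomial.aeval (⟨τ, hτ𝒜⟩ : 𝒜) (minpoly ℝ (τ : Matrix (Fin n) (Fin n) ℝ)) = 0 := by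
      apply Subtype.ext
      rw [← Subalgebra.coe_val, ← Polynomial.aeval_algHom_apply]
      exact minpoly.aeval _ _
    rw [this, map_zero]
  obtain ⟨z, hz⟩ := hCint' v hv
  have h1 := hτ𝒜.1 _ (hBC' v hv)
  have h2 := hV _ (hτ𝒜.2 _ (hB (C.mulVec v)))
  have h3 : C.mulVec ((τ : Matrix (Fin n) (Fin n) ℝ).mulVec (B.mulVec (C.mulVec v))) =
      C.mulVec v := by
    rw [Matrix.mulVec_mulVec, Matrix.mulVec_mulVec, hΦ, Matrix.one_mulVec]
  rw [h3] at h2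
  have h4 : B.mulVec (C.mulVec v) ∈ H := hz ▸ hBint' z
  have h5 := H.add_mem (H.add_mem (H.mem_of_mem_linealitySubmodule h1)
    (H.mem_of_mem_linealitySubmodule h2)) h4
  rw [Matrix.mulVec_sub] at h5
  simpa using h5
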